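/- Under the stated smoothness assumptions, the leading-order behavior of the rate function near the at-the-money point is lim_{x → 0} I_ρ(S₀, V₀, V₀ η²(S₀) e^x) / x² = 3 / (2(σ₀² + 4ρσ₀√V₀ η₁ + 4η₁² V₀)). -/

import Mathlib

open MeasureTheory

/-- `f : [0,1] → ℝ` is absolutely continuous with square-integrable derivative `f'`. -/
def AC (f f' : ℝ → ℝ) : Prop :=
  IntervalIntegrable f' MeasureTheory.volume 0 1 ∧
  IntervalIntegrable (fun t => (f' t) ^ 2) MeasureTheory.volume 0 1 ∧
  ∀ t ∈ Set.Icc (0 : ℝ) 1, f t = f 0 + ∫ s in (0 : ℝ)..t, f' s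

/-- The functional `Λ_ρ[g,h]` (with chosen derivatives `g'`, `h'`). -/
noncomputable def Lam (η σ : ℝ → ℝ) (ρ : ℝ) (g g' h h' : ℝ → ℝ) : ℝ :=
  (1 / (2 * (1 - ρ ^ 2))) *
    (∫ t in (0 : ℝ)..1,
      (g' t / (η (Real.exp (g t)) * Real.sqrt (Real.exp (h t))) -
        ρ * h' t / σ (Real.exp (h t))) ^ 2) +
  (1 / 2) * (∫ t in (0 : ℝ)..1, (h' t / σ (Real.exp (h t))) ^ 2)

/-- Admissible values of the variational problem defining the rate function. -/
def RateValues (η σ : ℝ → ℝ) (ρ S₀ V₀ K : ℝ) : Set ℝ :=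
  {y | ∃ g g' h h' : ℝ → ℝ, AC g g' ∧ AC h h' ∧
    g 0 = Real.log S₀ ∧ h 0 = Real.log V₀ ∧
    (∫ t in (0 : ℝ)..1, Real.exp (h t) * (η (Real.exp (g t))) ^ 2) = K ∧
    y = Lam η σ ρ g g' h h'}

/-- The rate function `I_ρ(S₀,V₀,K)`. -/
noncomputable def RateI (η σ : ℝ → ℝ) (ρ S₀ V₀ K : ℝ) : ℝ :=
  sInf (RateValues η σ ρ S₀ V₀ K)

open Filter

open Topology

lemma AC.continuousOn {f f' : ℝ → ℝ} (hf : AC f f') : ContinuousOn f (Set.Icc 0 1) := by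
  have h := intervalIntegral.continuousOn_primitive_interval' hf.1 Set.left_mem_uIcc
  rw [Set.uIcc_of_le zero_le_one] at h
  exact (continuousOn_const.add h).congr hf.2.2

lemma AC.memLp_two {f f' : ℝ → ℝ} (hf : AC f f') :
    MemLp f' 2 (volume.restrict (Set.Ioc (0 : ℝ) 1)) := by
  have h₁ := (intervalIntegrable_iff_integrableOn_Ioc_of_le zero_le_one).1 hf.1
  have h₂ := (intervalIntegrable_iff_integrableOn_Ioc_of_le zero_le_one).1 hf.2.1
  exact (memLp_two_iff_integrable_sq h₁.aestronglyMeasurable).2 h₂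

lemma AC.integral_sub_eq {f f' : ℝ → ℝ} (hf : AC f f') :
    ∫ t in (0 : ℝ)..1, (f t - f 0) = ∫ t in (0 : ℝ)..1, (1 - t) * f' t := by
  have hF := hf.1.absolutelyContinuousOnInterval_intervalIntegral (c := 0) Set.left_mem_uIcc
  have hG : AbsolutelyContinuousOnInterval (fun t : ℝ => 1 - t) 0 1 := by
    have : LipschitzWith 1 (fun t : ℝ => 1 - t) :=
      LipschitzWith.of_dist_le_mul fun x y => by rw [dist_sub_left]; simp
    exact this.lipschitzOnWith.absolutelyContinuousOnInterval
  have h := hF.integral_mul_deriv_eq_deriv_mul hG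
  have hd : ∀ t : ℝ, deriv (fun t : ℝ => 1 - t) t = -1 := fun t => by simp
  simp only [hd, intervalIntegral.integral_same, sub_self, mul_zero, zero_mul, zero_sub, mul_neg,
    mul_one, intervalIntegral.integral_neg, neg_inj] at h
  have h₁ : ∫ t in (0 : ℝ)..1, (f t - f 0) = ∫ t in (0 : ℝ)..1, ∫ s in (0 : ℝ)..t, f' s := by
    refine intervalIntegral.integral_congr fun t ht => ?_
    rw [Set.uIcc_of_le zero_le_one] at ht
    rw [hf.2.2 t ht, add_sub_cancel_left]
  rw [h₁, h]
  refine intervalIntegral.integral_congr_ae ?_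
  filter_upwards [hf.1.ae_hasDerivAt_integral] with t ht hmem
  rw [(ht (Set.uIoc_subset_uIcc hmem) 0 Set.left_mem_uIcc).deriv]
  ring

lemma AC.abs_sub_le {f f' : ℝ → ℝ} (hf : AC f f') {t : ℝ} (ht : t ∈ Set.Icc (0 : ℝ) 1) :
    |f t - f 0| ≤ ∫ s in Set.Ioc (0 : ℝ) 1, |f' s| := by
  rw [hf.2.2 t ht, add_sub_cancel_left, intervalIntegral.integral_of_le ht.1]
  refine abs_integral_le_integral_abs.trans ?_
  have h₁ := (intervalIntegrable_iff_integrableOn_Ioc_of_le zero_le_one).1 hf.1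
  exact setIntegral_mono_set h₁.abs (ae_of_all _ fun _ => abs_nonneg _)
    (Set.Ioc_subset_Ioc_right ht.2).eventuallyLE

lemma integral_abs_le_sqrt_integral_sq {α : Type*} [MeasurableSpace α] {μ : Measure α}
    [IsProbabilityMeasure μ] {f : α → ℝ} (hf : MemLp f 2 μ) :
    ∫ x, |f x| ∂μ ≤ √(∫ x, f x ^ 2 ∂μ) := by
  refine Real.le_sqrt_of_sq_le ?_
  have hi : Integrable (fun x => |f x|) μ := (hf.integrable one_le_two).abs
  set m := ∫ x, |f x| ∂μ with hm
  have h : 0 ≤ ∫ x, (|f x| - m) ^ 2 ∂μ := integral_nonneg fun _ => sq_nonneg _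
  have h' : ∫ x, (|f x| - m) ^ 2 ∂μ = ∫ x, f x ^ 2 ∂μ - 2 * m * m + m ^ 2 := by
    have : ∀ x, (|f x| - m) ^ 2 = f x ^ 2 - 2 * m * |f x| + m ^ 2 := fun x => by
      rw [sub_sq, sq_abs]; ring
    simp_rw [this]
    rw [integral_add, integral_sub hf.integrable_sq (hi.const_mul _), integral_const_mul]
    · simp [← hm]
    · exact hf.integrable_sq.sub (hi.const_mul _)
    · exact integrable_const _
  nlinarith

/-- Multiplying a square-integrable function by a function continuous on `[0,1]`. -/
lemma MeasureTheory.MemLp.mul_continuousOn_Icc {f w : ℝ → ℝ}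
    (hf : MemLp f 2 (volume.restrict (Set.Ioc (0 : ℝ) 1)))
    (hw : ContinuousOn w (Set.Icc 0 1)) :
    MemLp (fun t => w t * f t) 2 (volume.restrict (Set.Ioc (0 : ℝ) 1)) := by
  obtain ⟨C, hC⟩ := isCompact_Icc.exists_bound_of_continuousOn hw
  refine hf.of_le_mul (c := C)
    (((hw.mono Set.Ioc_subset_Icc_self).aestronglyMeasurable measurableSet_Ioc).mul
      hf.aestronglyMeasurable) ?_
  filter_upwards [ae_restrict_mem measurableSet_Ioc] with t ht
  rw [norm_mul]
  exact mul_le_mul_of_nonneg_right (hC t (Set.Ioc_subset_Icc_self ht)) (norm_nonneg _)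

lemma integral_one_sub_sq : ∫ t in (0 : ℝ)..1, (1 - t) ^ 2 = 1 / 3 := by
  rw [intervalIntegral.integral_comp_sub_left (fun t : ℝ => t ^ 2)]
  norm_num [integral_pow]

/-- The quadratic minimisation underlying the leading-order behaviour: the cost of controls
`a, b` realising a given weighted average. -/
lemma sq_integral_le_cost {ρ θ s D : ℝ} (hρ : ρ ∈ Set.Ioo (-1 : ℝ) 1)
    (hD : D = s ^ 2 + 2 * ρ * s * θ + θ ^ 2) (hDpos : 0 < D) {a b : ℝ → ℝ}
    (ha : MemLp a 2 (volume.restrict (Set.Ioc (0 : ℝ) 1)))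
    (hb : MemLp b 2 (volume.restrict (Set.Ioc (0 : ℝ) 1))) :
    (∫ t in Set.Ioc (0 : ℝ) 1, (1 - t) * (s * b t + θ * a t)) ^ 2 ≤
      D / 3 * ((1 - ρ ^ 2)⁻¹ * (∫ t in Set.Ioc (0 : ℝ) 1, (a t - ρ * b t) ^ 2) +
        ∫ t in Set.Ioc (0 : ℝ) 1, b t ^ 2) := by
  have hr : 0 < 1 - ρ ^ 2 := by nlinarith [hρ.1, hρ.2]
  have hc : MemLp (fun t => a t - ρ * b t) 2 (volume.restrict (Set.Ioc (0 : ℝ) 1)) :=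
    ha.sub (hb.const_mul ρ)
  have hl : MemLp (fun t => (1 - t) * (s * b t + θ * a t)) 2
      (volume.restrict (Set.Ioc (0 : ℝ) 1)) :=
    ((hb.const_mul s).add (ha.const_mul θ)).mul_continuousOn_Icc (by fun_prop)
  have hq : ∫ t in Set.Ioc (0 : ℝ) 1, (1 - t) ^ 2 = 1 / 3 := by
    rw [← intervalIntegral.integral_of_le zero_le_one, integral_one_sub_sq]
  have hqi : Integrable (fun t : ℝ => (1 - t) ^ 2) (volume.restrict (Set.Ioc (0 : ℝ) 1)) :=
    (Continuous.integrableOn_Ioc (by fun_prop))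
  set X := ∫ t in Set.Ioc (0 : ℝ) 1, (1 - t) * (s * b t + θ * a t) with hX
  set P := ∫ t in Set.Ioc (0 : ℝ) 1, (a t - ρ * b t) ^ 2 with hP
  set Q := ∫ t in Set.Ioc (0 : ℝ) 1, b t ^ 2 with hQ
  have key : ∀ l : ℝ, 0 ≤ (1 - ρ ^ 2)⁻¹ * P + Q - 2 * l * X + l ^ 2 * D * (1 / 3) := by
    intro l
    have h : 0 ≤ ∫ t in Set.Ioc (0 : ℝ) 1,
        ((1 - ρ ^ 2)⁻¹ * (a t - ρ * b t - l * (1 - ρ ^ 2) * θ * (1 - t)) ^ 2 +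
          (b t - l * (s + ρ * θ) * (1 - t)) ^ 2) :=
      integral_nonneg fun t => by positivity
    have h' : ∀ t, (1 - ρ ^ 2)⁻¹ * (a t - ρ * b t - l * (1 - ρ ^ 2) * θ * (1 - t)) ^ 2 +
          (b t - l * (s + ρ * θ) * (1 - t)) ^ 2 =
        (1 - ρ ^ 2)⁻¹ * (a t - ρ * b t) ^ 2 + b t ^ 2 -
          2 * l * ((1 - t) * (s * b t + θ * a t)) + l ^ 2 * D * (1 - t) ^ 2 := fun t => by
      rw [hD]; field_simp; ring
    simp_rw [h'] at h
    rwa [integral_add, integral_sub, integral_add, integral_const_mul, integral_const_mul,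
      integral_const_mul, hq, ← hX, ← hP, ← hQ] at h
    · exact hc.integrable_sq.const_mul _
    · exact hb.integrable_sq
    · exact (hc.integrable_sq.const_mul _).add hb.integrable_sq
    · exact (hl.integrable one_le_two).const_mul _
    · exact ((hc.integrable_sq.const_mul _).add hb.integrable_sq).sub
        ((hl.integrable one_le_two).const_mul _)
    · exact hqi.const_mul _
  have h := key (3 * X / D)
  have h2 : (1 - ρ ^ 2)⁻¹ * P + Q - 2 * (3 * X / D) * X + (3 * X / D) ^ 2 * D * (1 / 3) =
      (1 - ρ ^ 2)⁻¹ * P + Q - 3 * X ^ 2 / D := by field_simp; ring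
  rw [h2] at h
  have h3 : 3 * X ^ 2 / D ≤ (1 - ρ ^ 2)⁻¹ * P + Q := by linarith
  rw [div_le_iff₀ hDpos] at h3
  nlinarith

/-- First-order upper bound for the deviation of the time-averaged variance in terms of the cost of
an admissible path, for abstract volatility coefficients `A` and `E`. -/
lemma abs_average_sub_one_le {A : ℝ × ℝ → ℝ} {E : ℝ → ℝ} {M M' κ ρ p₀ q₀ D : ℝ}
    (hA : Continuous A) (hE : Continuous E) (hApos : ∀ z, 0 < A z) (hEpos : ∀ q, 0 < E q)
    (hEM : ∀ q, E q ≤ M) (hAM : ∀ z, A z ≤ M' * √(Real.exp z.2))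
    (hexp : ∀ ε > 0, ∃ δ > 0, ∀ p q, |p - p₀| ≤ δ → |q - q₀| ≤ δ →
      |A (p, q) ^ 2 / A (p₀, q₀) ^ 2 - 1 - ((q - q₀) + κ * (p - p₀))| ≤
        ε * (|p - p₀| + |q - q₀|))
    (hρ : ρ ∈ Set.Ioo (-1 : ℝ) 1)
    (hD : D = E q₀ ^ 2 + 2 * ρ * E q₀ * (κ * A (p₀, q₀)) + (κ * A (p₀, q₀)) ^ 2)
    (hDpos : 0 < D) {ε : ℝ} (hε : 0 < ε) :
    ∃ δ > 0, ∀ g g' h h' : ℝ → ℝ, AC g g' → AC h h' → g 0 = p₀ → h 0 = q₀ → ∀ y : ℝ,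
      y = (1 / (2 * (1 - ρ ^ 2))) *
          (∫ t in (0 : ℝ)..1, (g' t / A (g t, h t) - ρ * h' t / E (h t)) ^ 2) +
        (1 / 2) * (∫ t in (0 : ℝ)..1, (h' t / E (h t)) ^ 2) → y ≤ δ →
      |(∫ t in (0 : ℝ)..1, A (g t, h t) ^ 2 / A (p₀, q₀) ^ 2) - 1| ≤
        (√(2 * D / 3) + ε) * √y := by
  have hr : 0 < 1 - ρ ^ 2 := by nlinarith [hρ.1, hρ.2]
  have hM : 0 < M := (hEpos 0).trans_le (hEM 0)
  have hM' : 0 < M' := by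
    have := (hApos (0, 0)).trans_le (hAM (0, 0))
    exact pos_of_mul_pos_left this (Real.sqrt_nonneg _)
  set B := M' * √(Real.exp (q₀ + M)) with hB
  have hBpos : 0 < B := by positivity
  set C := M + 2 * B with hC
  have hCpos : 0 < C := by positivity
  set e := ε / (√2 * (1 + 2 * |κ| + 2 * C)) with he
  have hepos : 0 < e := by positivity
  obtain ⟨δ₁, hδ₁, h₁⟩ := hexp e hepos
  obtain ⟨δ₂, hδ₂, h₂⟩ := Metric.continuousAt_iff.1 (hA.continuousAt (x := (p₀, q₀))) e hepos
  obtain ⟨δ₃, hδ₃, h₃⟩ := Metric.continuousAt_iff.1 (hE.continuousAt (x := q₀)) e hepos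
  set d := min 1 (min δ₁ (min (δ₂ / 2) (δ₃ / 2)) / C) with hd
  have hdpos : 0 < d := by positivity
  refine ⟨d ^ 2 / 2, by positivity, ?_⟩
  rintro g g' h h' hg hh hg0 hh0 y hy hyδ
  have hgc := hg.continuousOn
  have hhc := hh.continuousOn
  have hAc : ContinuousOn (fun t => A (g t, h t)) (Set.Icc 0 1) :=
    hA.comp_continuousOn (hgc.prodMk hhc)
  have hEc : ContinuousOn (fun t => E (h t)) (Set.Icc 0 1) := hE.comp_continuousOn hhc
  set μ := volume.restrict (Set.Ioc (0 : ℝ) 1) with hμ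
  have : IsProbabilityMeasure μ := ⟨by simp [hμ]⟩
  have hmem : ∀ᵐ t ∂μ, t ∈ Set.Ioc (0 : ℝ) 1 := ae_restrict_mem measurableSet_Ioc
  set a : ℝ → ℝ := fun t => g' t / A (g t, h t) with ha
  set b : ℝ → ℝ := fun t => h' t / E (h t) with hb
  have hga : ∀ t, g' t = A (g t, h t) * a t := fun t => by
    rw [ha]; field_simp [(hApos (g t, h t)).ne']
  have hhb : ∀ t, h' t = E (h t) * b t := fun t => by
    rw [hb]; field_simp [(hEpos (h t)).ne']
  have ha2 : MemLp a 2 μ := by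
    have := hg.memLp_two.mul_continuousOn_Icc (hAc.inv₀ fun t _ => (hApos _).ne')
    simpa only [ha, div_eq_inv_mul, Pi.inv_apply] using this
  have hb2 : MemLp b 2 μ := by
    have := hh.memLp_two.mul_continuousOn_Icc (hEc.inv₀ fun t _ => (hEpos _).ne')
    simpa only [hb, div_eq_inv_mul, Pi.inv_apply] using this
  have hc2 : MemLp (fun t => a t - ρ * b t) 2 μ := ha2.sub (hb2.const_mul ρ)
  have hai : Integrable (fun t => |a t|) μ := (ha2.integrable one_le_two).abs
  have hbi : Integrable (fun t => |b t|) μ := (hb2.integrable one_le_two).abs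
  have hci : Integrable (fun t => |a t - ρ * b t|) μ := (hc2.integrable one_le_two).abs
  set P := ∫ t, (a t - ρ * b t) ^ 2 ∂μ with hP
  set Q := ∫ t, b t ^ 2 ∂μ with hQ
  have hP0 : 0 ≤ P := integral_nonneg fun _ => sq_nonneg _
  have hQ0 : 0 ≤ Q := integral_nonneg fun _ => sq_nonneg _
  have hy2 : 2 * y = (1 - ρ ^ 2)⁻¹ * P + Q := by
    have e₁ : ∫ t in (0 : ℝ)..1, (g' t / A (g t, h t) - ρ * h' t / E (h t)) ^ 2 = P := by
      rw [intervalIntegral.integral_of_le zero_le_one, hP]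
      simp only [ha, hb, mul_div_assoc, hμ]
    have e₂ : ∫ t in (0 : ℝ)..1, (h' t / E (h t)) ^ 2 = Q := by
      rw [intervalIntegral.integral_of_le zero_le_one, hQ]
    rw [hy, e₁, e₂]
    field_simp
  set N := √(2 * y) with hN
  have hN0 : 0 ≤ N := Real.sqrt_nonneg _
  have hPle : P ≤ (1 - ρ ^ 2)⁻¹ * P :=
    le_mul_of_one_le_left hP0 ((one_le_inv₀ hr).2 (by nlinarith [sq_nonneg ρ]))
  have hy0 : 0 ≤ 2 * y := by rw [hy2]; linarith
  have hNd : N ≤ d := by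
    rw [hN, Real.sqrt_le_left hdpos.le]; linarith
  have hNone : N ≤ 1 := hNd.trans (min_le_left _ _)
  have hCN : C * N ≤ min δ₁ (min (δ₂ / 2) (δ₃ / 2)) := by
    have : N ≤ min δ₁ (min (δ₂ / 2) (δ₃ / 2)) / C := hNd.trans (min_le_right _ _)
    rw [le_div_iff₀ hCpos] at this
    linarith
  have hbN : ∫ t, |b t| ∂μ ≤ N :=
    (integral_abs_le_sqrt_integral_sq hb2).trans (Real.sqrt_le_sqrt (by rw [hy2]; linarith))
  have hcN : ∫ t, |a t - ρ * b t| ∂μ ≤ N :=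
    (integral_abs_le_sqrt_integral_sq hc2).trans (Real.sqrt_le_sqrt (by rw [hy2]; linarith))
  have haN : ∫ t, |a t| ∂μ ≤ 2 * N := by
    have : ∫ t, |a t| ∂μ ≤ ∫ t, (|a t - ρ * b t| + |b t|) ∂μ := by
      refine integral_mono hai (hci.add hbi) fun t => ?_
      have h1 : |a t| ≤ |a t - ρ * b t| + |ρ * b t| := by
        simpa using abs_add_le (a t - ρ * b t) (ρ * b t)
      have h2 : |ρ * b t| ≤ |b t| := by
        rw [abs_mul]
        exact mul_le_of_le_one_left (abs_nonneg _) (abs_le.2 ⟨hρ.1.le, hρ.2.le⟩)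
      exact h1.trans (by linarith)
    rw [integral_add hci hbi] at this
    linarith
  have hv : ∀ t ∈ Set.Icc (0 : ℝ) 1, |h t - q₀| ≤ M * N := fun t ht => by
    rw [← hh0]
    refine (hh.abs_sub_le ht).trans ?_
    calc ∫ s, |h' s| ∂μ ≤ ∫ s, M * |b s| ∂μ := by
          refine integral_mono (hh.memLp_two.integrable one_le_two).abs (hbi.const_mul _)
            fun s => ?_
          simp only
          rw [hhb s, abs_mul, abs_of_pos (hEpos _)]
          exact mul_le_mul_of_nonneg_right (hEM _) (abs_nonneg _)
      _ ≤ M * N := by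
          rw [integral_const_mul]; exact mul_le_mul_of_nonneg_left hbN hM.le
  have hAB : ∀ t ∈ Set.Icc (0 : ℝ) 1, A (g t, h t) ≤ B := fun t ht => by
    refine (hAM _).trans (mul_le_mul_of_nonneg_left (Real.sqrt_le_sqrt (Real.exp_le_exp.2 ?_))
      hM'.le)
    have := (abs_le.1 (hv t ht)).2
    have : M * N ≤ M := mul_le_of_le_one_right hM.le hNone
    simp only
    linarith
  have hu : ∀ t ∈ Set.Icc (0 : ℝ) 1, |g t - p₀| ≤ 2 * B * N := fun t ht => by
    rw [← hg0]
    refine (hg.abs_sub_le ht).trans ?_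
    calc ∫ s, |g' s| ∂μ ≤ ∫ s, B * |a s| ∂μ := by
          refine integral_mono_ae (hg.memLp_two.integrable one_le_two).abs (hai.const_mul _) ?_
          filter_upwards [hmem] with s hs
          rw [hga s, abs_mul, abs_of_pos (hApos _)]
          exact mul_le_mul_of_nonneg_right (hAB _ (Set.Ioc_subset_Icc_self hs)) (abs_nonneg _)
      _ ≤ 2 * B * N := by
          rw [integral_const_mul]
          have := mul_le_mul_of_nonneg_left haN hBpos.le
          linarith
  have hMN : 0 ≤ M * N := by positivity
  have hBN : 0 ≤ B * N := by positivity
  have hCN' : C * N = M * N + 2 * B * N := by rw [hC]; ring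
  have hv' : ∀ t ∈ Set.Icc (0 : ℝ) 1, |h t - q₀| ≤ C * N := fun t ht =>
    (hv t ht).trans (by rw [hCN']; linarith)
  have hu' : ∀ t ∈ Set.Icc (0 : ℝ) 1, |g t - p₀| ≤ C * N := fun t ht =>
    (hu t ht).trans (by rw [hCN']; linarith)
  obtain ⟨hC1, hC2, hC3⟩ : C * N ≤ δ₁ ∧ C * N ≤ δ₂ / 2 ∧ C * N ≤ δ₃ / 2 := by
    simpa only [le_min_iff] using hCN
  have hEe : ∀ t ∈ Set.Icc (0 : ℝ) 1, |E (h t) - E q₀| ≤ e := fun t ht => by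
    have := h₃ (x := h t) (by rw [Real.dist_eq]; have := hv' t ht; linarith)
    exact this.le
  have hAe : ∀ t ∈ Set.Icc (0 : ℝ) 1, |A (g t, h t) - A (p₀, q₀)| ≤ e := fun t ht => by
    have := h₂ (x := (g t, h t)) (by
      rw [Prod.dist_eq, max_lt_iff, Real.dist_eq, Real.dist_eq]
      have h1 := hv' t ht
      have h2 := hu' t ht
      exact ⟨by simp only; linarith, by simp only; linarith⟩)
    exact this.le
  -- comparison of the linearised average with its frozen-coefficient version
  set θ := κ * A (p₀, q₀) with hθ
  set X := ∫ t, (1 - t) * (E q₀ * b t + θ * a t) ∂μ with hX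
  set Y := ∫ t, ((h t - q₀) + κ * (g t - p₀)) ∂μ with hY
  have hvi : Integrable (fun t => h t - q₀) μ :=
    ((hhc.sub continuousOn_const).integrableOn_Icc).mono_set Set.Ioc_subset_Icc_self
  have hui : Integrable (fun t => g t - p₀) μ :=
    ((hgc.sub continuousOn_const).integrableOn_Icc).mono_set Set.Ioc_subset_Icc_self
  have hh'i : Integrable (fun t => (1 - t) * h' t) μ :=
    (hh.memLp_two.mul_continuousOn_Icc (by fun_prop)).integrable one_le_two
  have hg'i : Integrable (fun t => (1 - t) * g' t) μ :=
    (hg.memLp_two.mul_continuousOn_Icc (by fun_prop)).integrable one_le_two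
  have hYeq : Y = ∫ t, ((1 - t) * h' t + κ * ((1 - t) * g' t)) ∂μ := by
    have e₁ := hh.integral_sub_eq
    have e₂ := hg.integral_sub_eq
    rw [intervalIntegral.integral_of_le zero_le_one, intervalIntegral.integral_of_le zero_le_one,
      ← hμ] at e₁ e₂
    rw [hh0] at e₁
    rw [hg0] at e₂
    rw [hY, integral_add hvi (hui.const_mul _), integral_add hh'i (hg'i.const_mul _),
      integral_const_mul, integral_const_mul, e₁, e₂]
  have hXi : Integrable (fun t => (1 - t) * (E q₀ * b t + θ * a t)) μ :=
    (((hb2.const_mul _).add (ha2.const_mul θ)).mul_continuousOn_Icc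
      (by fun_prop)).integrable one_le_two
  have hYX : |Y - X| ≤ e * (1 + 2 * |κ|) * N := by
    have hsum : Integrable (fun t => (1 - t) * h' t + κ * ((1 - t) * g' t)) μ :=
      hh'i.add (hg'i.const_mul _)
    rw [hYeq, hX, ← integral_sub hsum hXi]
    refine abs_integral_le_integral_abs.trans ?_
    calc _ ≤ ∫ t, (e * |b t| + |κ| * e * |a t|) ∂μ := by
          refine integral_mono_ae (hsum.sub hXi).abs
            ((hbi.const_mul _).add (hai.const_mul _)) ?_
          filter_upwards [hmem] with t ht
          have ht' := Set.Ioc_subset_Icc_self ht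
          have : (1 - t) * h' t + κ * ((1 - t) * g' t) - (1 - t) * (E q₀ * b t + θ * a t) =
              (1 - t) * ((E (h t) - E q₀) * b t + κ * (A (g t, h t) - A (p₀, q₀)) * a t) := by
            rw [hga, hhb, hθ]; ring
          rw [this, abs_mul]
          have h1 : |1 - t| ≤ 1 := abs_le.2 ⟨by linarith [ht.2], by linarith [ht.1]⟩
          refine (mul_le_of_le_one_left (abs_nonneg _) h1).trans ((abs_add_le _ _).trans ?_)
          rw [abs_mul, abs_mul, abs_mul]
          gcongr
          · exact hEe t ht'
          · exact hAe t ht'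
      _ = e * ∫ t, |b t| ∂μ + |κ| * e * ∫ t, |a t| ∂μ := by
          rw [integral_add (hbi.const_mul _) (hai.const_mul _), integral_const_mul,
            integral_const_mul]
      _ ≤ e * N + |κ| * e * (2 * N) := by gcongr
      _ = _ := by ring
  have hΦi : Integrable (fun t => A (g t, h t) ^ 2 / A (p₀, q₀) ^ 2) μ :=
    (((hAc.pow 2).div_const _).integrableOn_Icc).mono_set Set.Ioc_subset_Icc_self
  have hKY : |(∫ t, A (g t, h t) ^ 2 / A (p₀, q₀) ^ 2 ∂μ) - 1 - Y| ≤ e * (2 * C) * N := by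
    have : (∫ t, A (g t, h t) ^ 2 / A (p₀, q₀) ^ 2 ∂μ) - 1 - Y =
        ∫ t, (A (g t, h t) ^ 2 / A (p₀, q₀) ^ 2 - 1 - ((h t - q₀) + κ * (g t - p₀))) ∂μ := by
      have hsum : Integrable (fun t => (h t - q₀) + κ * (g t - p₀)) μ :=
        hvi.add (hui.const_mul _)
      have hdiff : Integrable (fun t => A (g t, h t) ^ 2 / A (p₀, q₀) ^ 2 - 1) μ :=
        hΦi.sub (integrable_const _)
      rw [integral_sub hdiff hsum, integral_sub hΦi (integrable_const _)]
      simp [hY]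
    rw [this, ← Real.norm_eq_abs]
    refine (norm_integral_le_of_norm_le_const (C := e * (2 * C) * N) ?_).trans (by simp)
    filter_upwards [hmem] with t ht
    have ht' := Set.Ioc_subset_Icc_self ht
    have h1 := hu' t ht'
    have h2 := hv' t ht'
    refine (h₁ _ _ (h1.trans hC1) (h2.trans hC1)).trans ?_
    calc _ ≤ e * (C * N + C * N) := by gcongr
      _ = _ := by ring
  have hXN : |X| ≤ √(D / 3) * N := by
    have := sq_integral_le_cost hρ hD hDpos ha2 hb2
    rw [← hμ, ← hX, ← hP, ← hQ, ← hy2] at this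
    rw [hN, ← Real.sqrt_mul (by positivity)]
    exact Real.abs_le_sqrt this
  rw [intervalIntegral.integral_of_le zero_le_one, ← hμ]
  set F := ∫ t, A (g t, h t) ^ 2 / A (p₀, q₀) ^ 2 ∂μ
  have htri : |F - 1| ≤ |F - 1 - Y| + |Y - X| + |X| := by
    have : F - 1 = (F - 1 - Y) + (Y - X) + X := by ring
    rw [this]
    simpa using abs_add_three (F - 1 - Y) (Y - X) X
  have hNy : N = √2 * √y := Real.sqrt_mul (by norm_num) _
  have heq : e * (1 + 2 * |κ| + 2 * C) * √2 = ε := by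
    rw [he]; field_simp
  have hs : √(2 * D / 3) = √(D / 3) * √2 := by
    rw [← Real.sqrt_mul (by positivity)]; ring_nf
  calc |F - 1| ≤ √(D / 3) * N + e * (1 + 2 * |κ| + 2 * C) * N := by linarith
    _ = _ := by rw [hNy, hs, ← heq]; ring

lemma integral_sub_sq_half : ∫ t in (0 : ℝ)..1, (t - t ^ 2 / 2) = 1 / 3 := by
  rw [intervalIntegral.integral_sub (Continuous.intervalIntegrable (by fun_prop) _ _)
    (Continuous.intervalIntegrable (by fun_prop) _ _), intervalIntegral.integral_div]
  norm_num [integral_pow]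

/-- Derivative at the base point of a time-averaged function along the paths
`t ↦ (p₀ + s m (t - t² / 2), q₀ + s n (t - t² / 2))`. -/
lemma hasDerivAt_average {Φ : ℝ × ℝ → ℝ} {κ p₀ q₀ : ℝ} (m n : ℝ) (hΦ : Continuous Φ)
    (hexp : ∀ ε > 0, ∃ δ > 0, ∀ p q, |p - p₀| ≤ δ → |q - q₀| ≤ δ →
      |Φ (p, q) - 1 - ((q - q₀) + κ * (p - p₀))| ≤ ε * (|p - p₀| + |q - q₀|)) :
    HasDerivAt (fun s : ℝ => ∫ t in (0 : ℝ)..1,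
      Φ (p₀ + s * m * (t - t ^ 2 / 2), q₀ + s * n * (t - t ^ 2 / 2))) ((n + κ * m) / 3) 0 := by
  have hΦ1 : Φ (p₀, q₀) = 1 := by
    obtain ⟨δ, hδ, h⟩ := hexp 1 one_pos
    have := h p₀ q₀ (by simpa using hδ.le) (by simpa using hδ.le)
    simp only [sub_self, mul_zero, add_zero, sub_zero, abs_zero] at this
    exact sub_eq_zero.1 (abs_eq_zero.1 (le_antisymm this (abs_nonneg _)))
  rw [hasDerivAt_iff_isLittleO_nhds_zero, Asymptotics.isLittleO_iff]
  intro c hc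
  set C := |m| + |n| + 1 with hC
  have hCpos : 0 < C := by positivity
  obtain ⟨δ, hδ, h⟩ := hexp (c / C) (by positivity)
  filter_upwards [Metric.ball_mem_nhds (0 : ℝ) (show 0 < δ / C by positivity)] with s hs
  rw [Metric.mem_ball, dist_zero_right, Real.norm_eq_abs, lt_div_iff₀ hCpos] at hs
  have hτ : ∀ t ∈ Set.Ioc (0 : ℝ) 1, |t - t ^ 2 / 2| ≤ 1 := fun t ht =>
    abs_le.2 ⟨by nlinarith [ht.1, ht.2], by nlinarith [ht.1, ht.2]⟩
  have hb : ∀ l : ℝ, ∀ t ∈ Set.Ioc (0 : ℝ) 1, |s * l * (t - t ^ 2 / 2)| ≤ |s| * |l| :=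
    fun l t ht => by
      rw [abs_mul, abs_mul]
      exact mul_le_of_le_one_right (by positivity) (hτ t ht)
  have hm0 := abs_nonneg m
  have hn0 := abs_nonneg n
  have hs0 := abs_nonneg s
  have hint : (∫ t in (0 : ℝ)..1,
        Φ (p₀ + (0 + s) * m * (t - t ^ 2 / 2), q₀ + (0 + s) * n * (t - t ^ 2 / 2))) -
      (∫ t in (0 : ℝ)..1, Φ (p₀ + 0 * m * (t - t ^ 2 / 2), q₀ + 0 * n * (t - t ^ 2 / 2))) -
      s • ((n + κ * m) / 3) =
      ∫ t in (0 : ℝ)..1, (Φ (p₀ + s * m * (t - t ^ 2 / 2), q₀ + s * n * (t - t ^ 2 / 2)) - 1 -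
        s * (n + κ * m) * (t - t ^ 2 / 2)) := by
    rw [intervalIntegral.integral_sub, intervalIntegral.integral_sub,
      intervalIntegral.integral_const_mul, integral_sub_sq_half]
    · simp [hΦ1]; ring
    all_goals exact Continuous.intervalIntegrable (by fun_prop) _ _
  rw [hint]
  have := intervalIntegral.norm_integral_le_of_norm_le_const (a := 0) (b := 1) (C := c * ‖s‖)
    (f := fun t => Φ (p₀ + s * m * (t - t ^ 2 / 2), q₀ + s * n * (t - t ^ 2 / 2)) - 1 -
        s * (n + κ * m) * (t - t ^ 2 / 2)) fun t ht => ?_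
  · simpa using this
  rw [Set.uIoc_of_le zero_le_one] at ht
  have h1 := h (p₀ + s * m * (t - t ^ 2 / 2)) (q₀ + s * n * (t - t ^ 2 / 2))
    (by rw [add_sub_cancel_left]; exact (hb m t ht).trans (by nlinarith))
    (by rw [add_sub_cancel_left]; exact (hb n t ht).trans (by nlinarith))
  rw [add_sub_cancel_left, add_sub_cancel_left] at h1
  have e₁ : s * n * (t - t ^ 2 / 2) + κ * (s * m * (t - t ^ 2 / 2)) =
      s * (n + κ * m) * (t - t ^ 2 / 2) := by ring
  rw [e₁] at h1
  refine h1.trans ?_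
  calc _ ≤ c / C * (|s| * C) := by
        gcongr
        have := hb m t ht
        have := hb n t ht
        nlinarith
    _ = c * ‖s‖ := by rw [Real.norm_eq_abs]; field_simp

lemma AC_quadratic (p m : ℝ) :
    AC (fun t => p + m * (t - t ^ 2 / 2)) (fun t => m * (1 - t)) := by
  refine ⟨Continuous.intervalIntegrable (by fun_prop) _ _,
    Continuous.intervalIntegrable (by fun_prop) _ _, fun t _ => ?_⟩
  rw [intervalIntegral.integral_eq_sub_of_hasDerivAt (f := fun t => m * (t - t ^ 2 / 2))]
  · ring
  · intro x _
    exact (((hasDerivAt_id x).sub (((hasDerivAt_id x).pow 2).div_const 2)).const_mul m).congr_deriv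
      (by simp)
  · exact Continuous.intervalIntegrable (by fun_prop) _ _

/-- Near-optimal admissible paths, for abstract volatility coefficients `A` and `E`. -/
lemma eventually_exists_path_cost_le {A : ℝ × ℝ → ℝ} {E : ℝ → ℝ} {κ ρ p₀ q₀ D : ℝ}
    (hA : Continuous A) (hE : Continuous E) (hApos : ∀ z, 0 < A z) (hEpos : ∀ q, 0 < E q)
    (hexp : ∀ ε > 0, ∃ δ > 0, ∀ p q, |p - p₀| ≤ δ → |q - q₀| ≤ δ →
      |A (p, q) ^ 2 / A (p₀, q₀) ^ 2 - 1 - ((q - q₀) + κ * (p - p₀))| ≤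
        ε * (|p - p₀| + |q - q₀|))
    (hρ : ρ ∈ Set.Ioo (-1 : ℝ) 1)
    (hD : D = E q₀ ^ 2 + 2 * ρ * E q₀ * (κ * A (p₀, q₀)) + (κ * A (p₀, q₀)) ^ 2)
    (hDpos : 0 < D) {ε : ℝ} (hε : 0 < ε) :
    ∀ᶠ x : ℝ in 𝓝[≠] 0, ∃ g g' h h' : ℝ → ℝ, AC g g' ∧ AC h h' ∧ g 0 = p₀ ∧ h 0 = q₀ ∧
      (∫ t in (0 : ℝ)..1, A (g t, h t) ^ 2 / A (p₀, q₀) ^ 2) = Real.exp x ∧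
      (1 / (2 * (1 - ρ ^ 2))) *
          (∫ t in (0 : ℝ)..1, (g' t / A (g t, h t) - ρ * h' t / E (h t)) ^ 2) +
        (1 / 2) * (∫ t in (0 : ℝ)..1, (h' t / E (h t)) ^ 2) ≤ (3 / (2 * D) + ε) * x ^ 2 := by
  have hr : 0 < 1 - ρ ^ 2 := by nlinarith [hρ.1, hρ.2]
  have hA0 := hApos (p₀, q₀)
  have hE0 := hEpos q₀
  set θ := κ * A (p₀, q₀) with hθ
  set m := A (p₀, q₀) * (ρ * E q₀ + θ) with hm
  set n := E q₀ * (E q₀ + ρ * θ) with hn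
  set G : ℝ → ℝ → ℝ := fun s t => p₀ + s * m * (t - t ^ 2 / 2) with hG
  set H : ℝ → ℝ → ℝ := fun s t => q₀ + s * n * (t - t ^ 2 / 2) with hH
  have hGH : Continuous fun z : ℝ × ℝ => A (G z.1 z.2, H z.1 z.2) := by
    simp only [hG, hH]; fun_prop
  have hHc : Continuous fun z : ℝ × ℝ => E (H z.1 z.2) := by
    simp only [hH]; fun_prop
  set Ψ : ℝ → ℝ := fun s => ∫ t in (0 : ℝ)..1, A (G s t, H s t) ^ 2 / A (p₀, q₀) ^ 2 with hΨ
  have hΨc : Continuous Ψ := by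
    refine intervalIntegral.continuous_parametric_intervalIntegral_of_continuous' ?_ 0 1
    exact (hGH.pow 2).div_const _
  have hΨ0 : Ψ 0 = 1 := by simp [hΨ, hG, hH, hA0.ne']
  have hnm : n + κ * m = D := by rw [hn, hm, hD, hθ]; ring
  have hΨd : HasDerivAt Ψ (D / 3) 0 := by
    have := hasDerivAt_average (Φ := fun z => A z ^ 2 / A (p₀, q₀) ^ 2) m n
      ((hA.pow 2).div_const _) hexp
    rwa [hnm] at this
  set J : ℝ → ℝ := fun s =>
    (1 / (2 * (1 - ρ ^ 2))) * (∫ t in (0 : ℝ)..1,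
      (m * (1 - t) / A (G s t, H s t) - ρ * (n * (1 - t)) / E (H s t)) ^ 2) +
    (1 / 2) * (∫ t in (0 : ℝ)..1, (n * (1 - t) / E (H s t)) ^ 2) with hJ
  have hJc : Continuous J := by
    refine (continuous_const.mul ?_).add (continuous_const.mul ?_)
    · refine intervalIntegral.continuous_parametric_intervalIntegral_of_continuous' ?_ 0 1
      refine Continuous.pow (Continuous.sub (Continuous.div ?_ hGH fun _ => (hApos _).ne')
        (Continuous.div ?_ hHc fun _ => (hEpos _).ne')) 2 <;> fun_prop
    · refine intervalIntegral.continuous_parametric_intervalIntegral_of_continuous' ?_ 0 1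
      refine Continuous.pow (Continuous.div ?_ hHc fun _ => (hEpos _).ne') 2
      fun_prop
  have hJ0 : J 0 = D / 6 := by
    have e₁ : ∀ t : ℝ, (m * (1 - t) / A (p₀, q₀) - ρ * (n * (1 - t)) / E q₀) ^ 2 =
        ((1 - ρ ^ 2) * θ) ^ 2 * (1 - t) ^ 2 := fun t => by
      rw [hm, hn]; field_simp; ring
    have e₂ : ∀ t : ℝ, (n * (1 - t) / E q₀) ^ 2 = (E q₀ + ρ * θ) ^ 2 * (1 - t) ^ 2 := fun t => by
      rw [hn]; field_simp
    simp only [hJ, hG, hH, zero_mul, add_zero, e₁, e₂, intervalIntegral.integral_const_mul,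
      integral_one_sub_sq]
    rw [hD]
    field_simp
    ring
  obtain ⟨e, he, hepos⟩ : ∃ e : ℝ,
      (3 / D * (1 + e)) ^ 2 * (D / 6 + e) < 3 / (2 * D) + ε ∧ 0 < e := by
    have hlim : Tendsto (fun e : ℝ => (3 / D * (1 + e)) ^ 2 * (D / 6 + e)) (𝓝[>] 0)
        (𝓝 ((3 / D * (1 + 0)) ^ 2 * (D / 6 + 0))) :=
      (Continuous.tendsto (by fun_prop) 0).mono_left nhdsWithin_le_nhds
    have hval : (3 / D * (1 + 0)) ^ 2 * (D / 6 + 0) = 3 / (2 * D) := by field_simp; ring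
    rw [hval] at hlim
    exact ((hlim.eventually (gt_mem_nhds (lt_add_of_pos_right _ hε))).and
      self_mem_nhdsWithin).exists
  set r := 3 / D * (1 + e) with hrdef
  have hrpos : 0 < r := by positivity
  have hJe : ∀ᶠ s in 𝓝 (0 : ℝ), J s < D / 6 + e :=
    hJc.continuousAt.eventually (gt_mem_nhds (by rw [hJ0]; linarith))
  obtain ⟨δ, hδ, hJδ⟩ := Metric.eventually_nhds_iff.1 hJe
  have hF : HasDerivAt (fun x => Ψ (r * x) - Real.exp x) e 0 := by
    have h1 : HasDerivAt (fun x => Ψ (r * x)) (D / 3 * r) 0 := by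
      have h2 : HasDerivAt (fun x : ℝ => r * x) r 0 := by
        simpa using (hasDerivAt_id (0 : ℝ)).const_mul r
      exact HasDerivAt.comp (h₂ := Ψ) 0 (by simpa using hΨd) h2
    refine (h1.sub (Real.hasDerivAt_exp 0)).congr_deriv ?_
    rw [hrdef, Real.exp_zero]; field_simp; ring
  have hslope : ∀ᶠ x in 𝓝[≠] (0 : ℝ), 0 < x⁻¹ * (Ψ (r * x) - Real.exp x) := by
    have := hasDerivAt_iff_tendsto_slope.1 hF
    filter_upwards [this.eventually (lt_mem_nhds hepos)] with x hx
    simpa [slope_def_field, hΨ0, div_eq_inv_mul] using hx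
  have hsmall : ∀ᶠ x in 𝓝[≠] (0 : ℝ), |x| < δ / r := by
    refine nhdsWithin_le_nhds ?_
    filter_upwards [Metric.ball_mem_nhds (0 : ℝ) (show 0 < δ / r by positivity)] with x hx
    simpa using hx
  filter_upwards [hslope, hsmall, self_mem_nhdsWithin] with x hx hxδ hx0
  have hmem : Real.exp x ∈ Set.uIcc (Ψ 0) (Ψ (r * x)) := by
    rw [hΨ0, Set.mem_uIcc]
    rcases lt_or_gt_of_ne hx0 with hneg | hpos
    · right
      have : Ψ (r * x) - Real.exp x < 0 := by
        by_contra! hcon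
        exact absurd hx (not_lt.2 (mul_nonpos_of_nonpos_of_nonneg (inv_nonpos.2 hneg.le) hcon))
      exact ⟨by linarith, Real.exp_le_one_iff.2 hneg.le⟩
    · left
      have := pos_of_mul_pos_right hx (inv_nonneg.2 hpos.le)
      exact ⟨Real.one_le_exp hpos.le, by linarith⟩
  obtain ⟨s, hs, hsx⟩ := intermediate_value_uIcc hΨc.continuousOn hmem
  have hsle : |s| ≤ r * |x| := by
    rw [← abs_of_pos hrpos, ← abs_mul]
    simpa using Set.abs_sub_left_of_mem_uIcc hs
  refine ⟨G s, fun t => s * m * (1 - t), H s, fun t => s * n * (1 - t), AC_quadratic _ _,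
    AC_quadratic _ _, by simp [hG], by simp [hH], hsx, ?_⟩
  have hcost : (1 / (2 * (1 - ρ ^ 2))) *
          (∫ t in (0 : ℝ)..1, (s * m * (1 - t) / A (G s t, H s t) -
            ρ * (s * n * (1 - t)) / E (H s t)) ^ 2) +
        (1 / 2) * (∫ t in (0 : ℝ)..1, (s * n * (1 - t) / E (H s t)) ^ 2) = s ^ 2 * J s := by
    have e₁ : ∀ t, (s * m * (1 - t) / A (G s t, H s t) -
            ρ * (s * n * (1 - t)) / E (H s t)) ^ 2 = s ^ 2 *
        (m * (1 - t) / A (G s t, H s t) - ρ * (n * (1 - t)) / E (H s t)) ^ 2 := fun t => by ring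
    have e₂ : ∀ t, (s * n * (1 - t) / E (H s t)) ^ 2 = s ^ 2 * (n * (1 - t) / E (H s t)) ^ 2 :=
      fun t => by ring
    simp only [e₁, e₂, intervalIntegral.integral_const_mul, hJ]
    ring
  rw [hcost]
  have hJs : J s ≤ D / 6 + e := by
    refine (hJδ ?_).le
    rw [Real.dist_eq, sub_zero]
    rw [lt_div_iff₀ hrpos] at hxδ
    linarith
  have hs2 : s ^ 2 ≤ r ^ 2 * x ^ 2 := by
    rw [← sq_abs s, ← sq_abs x, ← mul_pow]
    exact pow_le_pow_left₀ (abs_nonneg _) hsle 2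
  calc s ^ 2 * J s ≤ s ^ 2 * (D / 6 + e) := by gcongr
    _ ≤ r ^ 2 * x ^ 2 * (D / 6 + e) := by gcongr
    _ = r ^ 2 * (D / 6 + e) * x ^ 2 := by ring
    _ ≤ _ := by gcongr

/-- First-order expansion of the normalised local variance in logarithmic coordinates. -/
lemma variance_first_order_expansion {η : ℝ → ℝ} {S₀ V₀ d : ℝ} (hS₀ : 0 < S₀) (hV₀ : 0 < V₀)
    (hη : HasDerivAt η d S₀) (hη0 : 0 < η S₀) {ε : ℝ} (hε : 0 < ε) :
    ∃ δ > 0, ∀ p q, |p - Real.log S₀| ≤ δ → |q - Real.log V₀| ≤ δ →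
      |(η (Real.exp p) * √(Real.exp q)) ^ 2 /
          (η (Real.exp (Real.log S₀)) * √(Real.exp (Real.log V₀))) ^ 2 - 1 -
          ((q - Real.log V₀) + 2 * (S₀ * d) / η S₀ * (p - Real.log S₀))| ≤
        ε * (|p - Real.log S₀| + |q - Real.log V₀|) := by
  have hp : HasDerivAt (fun p => η (Real.exp p) ^ 2) (2 * η S₀ * (d * S₀)) (Real.log S₀) := by
    have h1 : HasDerivAt (fun p => η (Real.exp p)) (d * S₀) (Real.log S₀) := by
      have h2 := Real.hasDerivAt_exp (Real.log S₀)
      rw [Real.exp_log hS₀] at h2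
      exact HasDerivAt.comp (h₂ := η) _ (by rwa [Real.exp_log hS₀]) h2
    refine (h1.pow 2).congr_deriv ?_
    rw [Real.exp_log hS₀]
    ring
  have hq : HasDerivAt Real.exp V₀ (Real.log V₀) := by
    simpa [Real.exp_log hV₀] using Real.hasDerivAt_exp (Real.log V₀)
  have hF : HasFDerivAt (fun z : ℝ × ℝ => η (Real.exp z.1) ^ 2 * Real.exp z.2)
      (η (Real.exp (Real.log S₀)) ^ 2 • (V₀ • ContinuousLinearMap.snd ℝ ℝ ℝ) +
        Real.exp (Real.log V₀) • ((2 * η S₀ * (d * S₀)) • ContinuousLinearMap.fst ℝ ℝ ℝ))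
      (Real.log S₀, Real.log V₀) := by
    have h1 := HasDerivAt.comp_hasFDerivAt (f := Prod.fst) (Real.log S₀, Real.log V₀) hp
      (hasFDerivAt_fst (𝕜 := ℝ) (E := ℝ) (F := ℝ))
    have h2 := HasDerivAt.comp_hasFDerivAt (f := Prod.snd) (Real.log S₀, Real.log V₀) hq
      (hasFDerivAt_snd (𝕜 := ℝ) (E := ℝ) (F := ℝ))
    exact h1.mul h2
  set K := V₀ * η S₀ ^ 2 with hK
  have hKpos : 0 < K := by positivity
  have hlo := (Asymptotics.isLittleO_iff.1 hF.isLittleO) (show 0 < ε * K by positivity)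
  obtain ⟨δ, hδ, h⟩ := Metric.eventually_nhds_iff.1 hlo
  refine ⟨δ / 2, by positivity, fun p q hp' hq' => ?_⟩
  have hdist : dist (p, q) (Real.log S₀, Real.log V₀) < δ := by
    rw [Prod.dist_eq, max_lt_iff, Real.dist_eq, Real.dist_eq]
    exact ⟨lt_of_le_of_lt hp' (half_lt_self hδ), lt_of_le_of_lt hq' (half_lt_self hδ)⟩
  have h1 := h hdist
  have hnorm : ‖(p, q) - (Real.log S₀, Real.log V₀)‖ ≤ |p - Real.log S₀| + |q - Real.log V₀| := by
    rw [Prod.mk_sub_mk, Prod.norm_mk, Real.norm_eq_abs, Real.norm_eq_abs]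
    exact max_le_add_of_nonneg (abs_nonneg _) (abs_nonneg _)
  simp only [Real.exp_log hS₀, Real.exp_log hV₀, Prod.mk_sub_mk, add_apply,
    smul_apply, ContinuousLinearMap.coe_fst', ContinuousLinearMap.coe_snd',
    smul_eq_mul] at h1
  rw [Real.exp_log hS₀, Real.exp_log hV₀, mul_pow, mul_pow, Real.sq_sqrt (Real.exp_pos q).le,
    Real.sq_sqrt hV₀.le]
  have heq : η (Real.exp p) ^ 2 * Real.exp q / (η S₀ ^ 2 * V₀) - 1 -
      (q - Real.log V₀ + 2 * (S₀ * d) / η S₀ * (p - Real.log S₀)) =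
      (η (Real.exp p) ^ 2 * Real.exp q - η S₀ ^ 2 * V₀ -
        (η S₀ ^ 2 * (V₀ * (q - Real.log V₀)) +
          V₀ * (2 * η S₀ * (d * S₀) * (p - Real.log S₀)))) / K := by
    rw [hK]; field_simp
  rw [heq, abs_div, abs_of_pos hKpos, div_le_iff₀ hKpos]
  rw [Real.norm_eq_abs] at h1
  refine h1.trans ?_
  rw [Prod.mk_sub_mk] at hnorm
  calc _ ≤ ε * K * (|p - Real.log S₀| + |q - Real.log V₀|) := by gcongr
    _ = _ := by ring

/-- leading-order behavior of the rate function near the ATM point: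
`I_ρ(S₀,V₀,V₀η²(S₀)e^x)/x² → 3/(2(σ₀² + 4ρσ₀√V₀η₁ + 4η₁²V₀))` as `x → 0`. -/
theorem rate_function_ATM_leading_order
    (S₀ V₀ ρ : ℝ) (hS₀ : 0 < S₀) (hV₀ : 0 < V₀) (hρ : ρ ∈ Set.Ioo (-1 : ℝ) 1)
    (η σ : ℝ → ℝ)
    (hη : ContDiffOn ℝ 2 η (Set.Ioi 0)) (hσ : ContDiffOn ℝ 2 σ (Set.Ioi 0))
    (mη Mη mσ Mσ : ℝ) (hmη : 0 < mη) (hmσ : 0 < mσ)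
    (hηb : ∀ x ∈ Set.Ioi (0 : ℝ), mη ≤ η x ∧ η x ≤ Mη)
    (hσb : ∀ x ∈ Set.Ioi (0 : ℝ), mσ ≤ σ x ∧ σ x ≤ Mσ)
    (η₁ σ₀ : ℝ) (hη₁ : η₁ = S₀ * deriv η S₀) (hσ₀ : σ₀ = σ V₀)
    (hDpos : 0 < σ₀ ^ 2 + 4 * ρ * σ₀ * Real.sqrt V₀ * η₁ + 4 * η₁ ^ 2 * V₀) :
    Tendsto (fun x : ℝ =>
        RateI η σ ρ S₀ V₀ (V₀ * (η S₀) ^ 2 * Real.exp x) / x ^ 2)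
      (nhdsWithin 0 {(0 : ℝ)}ᶜ)
      (nhds (3 / (2 * (σ₀ ^ 2 + 4 * ρ * σ₀ * Real.sqrt V₀ * η₁ + 4 * η₁ ^ 2 * V₀)))) := by
  have hη0 : 0 < η S₀ := hmη.trans_le (hηb S₀ hS₀).1
  have hr : 0 < 1 - ρ ^ 2 := by nlinarith [hρ.1, hρ.2]
  set D := σ₀ ^ 2 + 4 * ρ * σ₀ * √V₀ * η₁ + 4 * η₁ ^ 2 * V₀ with hDdef
  set A : ℝ × ℝ → ℝ := fun z => η (Real.exp z.1) * √(Real.exp z.2) with hAdef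
  set E : ℝ → ℝ := fun q => σ (Real.exp q) with hEdef
  have hηc : Continuous fun p => η (Real.exp p) :=
    hη.continuousOn.comp_continuous Real.continuous_exp Real.exp_pos
  have hA : Continuous A :=
    (hηc.comp continuous_fst).mul (Real.continuous_exp.comp continuous_snd).sqrt
  have hE : Continuous E := hσ.continuousOn.comp_continuous Real.continuous_exp Real.exp_pos
  have hApos : ∀ z, 0 < A z := fun z =>
    mul_pos (hmη.trans_le (hηb _ (Real.exp_pos _)).1) (Real.sqrt_pos.2 (Real.exp_pos _))
  have hEpos : ∀ q, 0 < E q := fun q => hmσ.trans_le (hσb _ (Real.exp_pos _)).1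
  have hEM : ∀ q, E q ≤ Mσ := fun q => (hσb _ (Real.exp_pos _)).2
  have hAM : ∀ z, A z ≤ Mη * √(Real.exp z.2) := fun z =>
    mul_le_mul_of_nonneg_right (hηb _ (Real.exp_pos _)).2 (Real.sqrt_nonneg _)
  have hηd : HasDerivAt η (deriv η S₀) S₀ :=
    ((hη.contDiffAt (Ioi_mem_nhds hS₀)).differentiableAt two_ne_zero).hasDerivAt
  have hA0 : A (Real.log S₀, Real.log V₀) = η S₀ * √V₀ := by
    simp only [hAdef, Real.exp_log hS₀, Real.exp_log hV₀]
  have hE0 : E (Real.log V₀) = σ₀ := by simp only [hEdef, Real.exp_log hV₀, hσ₀]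
  have hexp : ∀ ε > 0, ∃ δ > 0, ∀ p q, |p - Real.log S₀| ≤ δ → |q - Real.log V₀| ≤ δ →
      |A (p, q) ^ 2 / A (Real.log S₀, Real.log V₀) ^ 2 - 1 -
        ((q - Real.log V₀) + 2 * η₁ / η S₀ * (p - Real.log S₀))| ≤
        ε * (|p - Real.log S₀| + |q - Real.log V₀|) := fun ε hε => by
    rw [hη₁]
    exact variance_first_order_expansion hS₀ hV₀ hηd hη0 hε
  have hD : D = E (Real.log V₀) ^ 2 + 2 * ρ * E (Real.log V₀) *
      (2 * η₁ / η S₀ * A (Real.log S₀, Real.log V₀)) +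
      (2 * η₁ / η S₀ * A (Real.log S₀, Real.log V₀)) ^ 2 := by
    have h1 : 2 * η₁ / η S₀ * (η S₀ * √V₀) = 2 * η₁ * √V₀ := by field_simp
    rw [hA0, hE0, h1, mul_pow, Real.sq_sqrt hV₀.le, hDdef]
    ring
  have hA02 : A (Real.log S₀, Real.log V₀) ^ 2 = V₀ * η S₀ ^ 2 := by
    rw [hA0, mul_pow, Real.sq_sqrt hV₀.le, mul_comm]
  have hK : 0 < V₀ * η S₀ ^ 2 := by positivity
  have hA2 : ∀ p q, A (p, q) ^ 2 = Real.exp q * η (Real.exp p) ^ 2 := fun p q => by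
    simp only [hAdef, mul_pow, Real.sq_sqrt (Real.exp_pos q).le]
    ring
  have haverage : ∀ (g h : ℝ → ℝ) (x : ℝ),
      (∫ t in (0 : ℝ)..1, Real.exp (h t) * (η (Real.exp (g t))) ^ 2) =
          V₀ * η S₀ ^ 2 * Real.exp x ↔
        (∫ t in (0 : ℝ)..1, A (g t, h t) ^ 2 / A (Real.log S₀, Real.log V₀) ^ 2) =
          Real.exp x := fun g h x => by
    simp only [hA2 (g _), hA02, intervalIntegral.integral_div]
    rw [div_eq_iff hK.ne', mul_comm (Real.exp x)]
  have hnonneg : ∀ x, ∀ y ∈ RateValues η σ ρ S₀ V₀ (V₀ * η S₀ ^ 2 * Real.exp x), 0 ≤ y := by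
    rintro x y ⟨g, g', h, h', -, -, -, -, -, rfl⟩
    have h1 := intervalIntegral.integral_nonneg (μ := volume) (zero_le_one' ℝ)
      (fun t _ => sq_nonneg (g' t / (η (Real.exp (g t)) * √(Real.exp (h t))) -
        ρ * h' t / σ (Real.exp (h t))))
    have h2 := intervalIntegral.integral_nonneg (μ := volume) (zero_le_one' ℝ)
      (fun t _ => sq_nonneg (h' t / σ (Real.exp (h t))))
    unfold Lam
    positivity
  have hupper : ∀ ε > 0, ∀ᶠ x in 𝓝[≠] (0 : ℝ),
      ∃ y ∈ RateValues η σ ρ S₀ V₀ (V₀ * η S₀ ^ 2 * Real.exp x),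
        y ≤ (3 / (2 * D) + ε) * x ^ 2 := by
    intro ε hε
    filter_upwards [eventually_exists_path_cost_le hA hE hApos hEpos hexp hρ hD hDpos hε]
      with x ⟨g, g', h, h', hg, hh, hg0, hh0, hgh, hle⟩
    exact ⟨_, ⟨g, g', h, h', hg, hh, hg0, hh0, (haverage g h x).2 hgh, rfl⟩, hle⟩
  have hlower : ∀ ε > 0, ∀ᶠ x in 𝓝[≠] (0 : ℝ),
      ∀ y ∈ RateValues η σ ρ S₀ V₀ (V₀ * η S₀ ^ 2 * Real.exp x),
        (3 / (2 * D) - ε) * x ^ 2 ≤ y := by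
    intro ε hε
    obtain ⟨e, he, hepos⟩ : ∃ e : ℝ, 3 / (2 * D) - ε < ((√(2 * D / 3) + e) ^ 2)⁻¹ ∧ 0 < e := by
      have hs : (√(2 * D / 3) + 0) ^ 2 = 2 * D / 3 := by
        rw [add_zero, Real.sq_sqrt (by positivity)]
      have hlim : Tendsto (fun e : ℝ => ((√(2 * D / 3) + e) ^ 2)⁻¹) (𝓝[>] 0)
          (𝓝 ((√(2 * D / 3) + 0) ^ 2)⁻¹) :=
        ((Continuous.tendsto (by fun_prop) 0).mono_left nhdsWithin_le_nhds).inv₀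
          (by rw [hs]; positivity)
      rw [hs, inv_div] at hlim
      exact ((hlim.eventually (lt_mem_nhds (sub_lt_self _ hε))).and self_mem_nhdsWithin).exists
    obtain ⟨δ, hδ, hmain⟩ := abs_average_sub_one_le hA hE hApos hEpos hEM hAM hexp hρ hD hDpos
      hepos
    set r := (√(2 * D / 3) + e) ^ 2 with hrdef
    have hrpos : 0 < r := by positivity
    have hlim : Tendsto (fun x : ℝ => ((Real.exp x - 1) / x) ^ 2 * r⁻¹) (𝓝[≠] 0)
        (𝓝 r⁻¹) := by
      have h1 := (hasDerivAt_iff_tendsto_slope.1 (Real.hasDerivAt_exp 0))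
      rw [Real.exp_zero] at h1
      have h2 : slope Real.exp 0 = fun x => (Real.exp x - 1) / x := by
        ext x
        simp [slope_def_field]
      rw [h2] at h1
      simpa using (h1.pow 2).mul_const r⁻¹
    have hsmall : ∀ᶠ x in 𝓝[≠] (0 : ℝ), (3 / (2 * D) - ε) * x ^ 2 < δ := by
      have hc : Continuous fun x : ℝ => (3 / (2 * D) - ε) * x ^ 2 := by fun_prop
      exact nhdsWithin_le_nhds (hc.continuousAt.eventually (gt_mem_nhds (by simpa using hδ)))
    filter_upwards [hlim.eventually (lt_mem_nhds he), hsmall, self_mem_nhdsWithin]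
      with x hx hxδ hx0
    rintro y hy
    have hy0 := hnonneg x y hy
    by_contra! hcon
    obtain ⟨g, g', h, h', hg, hh, hg0, hh0, hgh, hyeq⟩ := hy
    have h1 := hmain g g' h h' hg hh hg0 hh0 y hyeq (hcon.trans hxδ).le
    rw [(haverage g h x).1 hgh] at h1
    have h2 : (Real.exp x - 1) ^ 2 ≤ r * y := by
      rw [← sq_abs, hrdef]
      calc _ ≤ ((√(2 * D / 3) + e) * √y) ^ 2 := pow_le_pow_left₀ (abs_nonneg _) h1 2
        _ = _ := by rw [mul_pow, Real.sq_sqrt hy0]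
    have hx2 : 0 < x ^ 2 := by
      have : x ≠ 0 := hx0
      positivity
    have h3 : ((Real.exp x - 1) / x) ^ 2 * r⁻¹ ≤ y / x ^ 2 := by
      rw [div_pow, ← div_eq_mul_inv, div_right_comm]
      gcongr
      rw [div_le_iff₀ hrpos]
      linarith
    have h4 := hx.trans_le h3
    rw [lt_div_iff₀ hx2] at h4
    exact lt_asymm h4 hcon
  rw [Metric.tendsto_nhds]
  intro ε hε
  filter_upwards [hupper (ε / 2) (half_pos hε), hlower (ε / 2) (half_pos hε),
    self_mem_nhdsWithin] with x ⟨y, hy, hyle⟩ hlow hx0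
  have hx2 : 0 < x ^ 2 := by
    have : x ≠ 0 := hx0
    positivity
  have h1 : RateI η σ ρ S₀ V₀ (V₀ * η S₀ ^ 2 * Real.exp x) ≤ (3 / (2 * D) + ε / 2) * x ^ 2 :=
    (csInf_le ⟨0, fun z hz => hnonneg x z hz⟩ hy).trans hyle
  have h2 : (3 / (2 * D) - ε / 2) * x ^ 2 ≤ RateI η σ ρ S₀ V₀ (V₀ * η S₀ ^ 2 * Real.exp x) :=
    le_csInf ⟨y, hy⟩ hlow
  rw [← div_le_iff₀ hx2] at h1
  rw [← le_div_iff₀ hx2] at h2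
  rw [Real.dist_eq, abs_lt]
  constructor <;> linarith
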